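/- Let (K, ∂) be a strict Fr^n-differential field and K ⊆ L an extension of Fr^n-differential fields. For any a ∈ L and m > 0: if ∂^m(a) is algebraic over K(a, ∂(a), …, ∂^{m-1}(a)), then ∂^m(a) is separably algebraic over K(a, ∂(a), …, ∂^{m-1}(a)). -/

import Mathlib

def IsFrDeriv {R : Type*} [CommRing R] (q : ℕ) (d : R → R) : Prop :=
  (∀ x y, d (x + y) = d x + d y) ∧ (∀ x y, d (x * y) = x ^ q * d y + y ^ q * d x)

namespace IsFrDeriv

variable {R : Type*} [CommRing R] {q : ℕ} {d : R → R}

theorem map_zero (hd : IsFrDeriv q d) : d 0 = 0 := by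
  simpa using hd.1 0 0

theorem map_one (hd : IsFrDeriv q d) : d 1 = 0 := by
  simpa using hd.2 1 1

theorem map_sum (hd : IsFrDeriv q d) {ι : Type*} (s : Finset ι) (f : ι → R) :
    d (∑ i ∈ s, f i) = ∑ i ∈ s, d (f i) := by
  classical
  induction s using Finset.induction_on with
  | empty => simpa using hd.map_zero
  | insert i s hi ih => rw [Finset.sum_insert hi, Finset.sum_insert hi, hd.1, ih]

theorem map_pow (hd : IsFrDeriv q d) (x : R) (k : ℕ) :
    d (x ^ (k + 1)) = (k + 1) * (x ^ q) ^ k * d x := by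
  induction k with
  | zero => simp
  | succ k ih =>
    rw [_root_.pow_succ x (k + 1), hd.2, ih]
    push_cast
    ring

theorem map_pow_char (hd : IsFrDeriv q d) (p : ℕ) [Fact p.Prime] [CharP R p] (x : R) :
    d (x ^ p) = 0 := by
  obtain ⟨k, hk⟩ := Nat.exists_eq_succ_of_ne_zero (Fact.out : p.Prime).ne_zero
  have h : ((k : R) + 1) = 0 := by
    have := CharP.cast_eq_zero R p
    rwa [hk, Nat.cast_succ] at this
  rw [hk, Nat.succ_eq_add_one, hd.map_pow, h]
  simp

end IsFrDeriv

section

open MvPolynomial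

variable {K L : Type*} [Field K] [Field L] [Algebra K L] {p n : ℕ} [Fact p.Prime]
  {dK : K → K} {dL : L → L}

theorem IsFrDeriv.eq_zero_of_sum_mul_pow_eq_zero [CharP L p]
    (hdK : IsFrDeriv (p ^ n) dK) (hdL : IsFrDeriv (p ^ n) dL)
    (hcompat : ∀ x : K, dL (algebraMap K L x) = algebraMap K L (dK x))
    (hstrict : ∀ x : K, dK x = 0 ↔ ∃ y : K, y ^ p = x) {ι : Type*} (u : ι → L) (s : Finset ι)
    (hu : LinearIndepOn K u (s : Set ι)) (e : ℕ) (c : ι → K)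
    (hc : ∑ i ∈ s, algebraMap K L (c i) * u i ^ p ^ e = 0) : ∀ i ∈ s, c i = 0 := by
  classical
  induction s using Finset.strongInduction generalizing e c with
  | H s ihs =>
    induction e generalizing c with
    | zero =>
      refine linearIndepOn_finset_iff.mp hu c ?_
      simpa [Algebra.smul_def] using hc
    | succ e ihe =>
      rintro i₀ hi₀
      by_contra h0
      set c' : ι → K := fun i ↦ (c i₀)⁻¹ * c i with hc'
      have hsum : ∑ i ∈ s, algebraMap K L (c' i) * u i ^ p ^ (e + 1) = 0 := by
        simp only [hc', _root_.map_mul, mul_assoc]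
        rw [← Finset.mul_sum, hc, mul_zero]
      have hone : c' i₀ = 1 := inv_mul_cancel₀ h0
      have hd : ∑ i ∈ s, algebraMap K L (dK (c' i)) * u i ^ p ^ (e + 1 + n) = 0 := by
        rw [← hdL.map_zero, ← hsum, hdL.map_sum]
        refine Finset.sum_congr rfl fun i _ ↦ ?_
        rw [hdL.2, hcompat, _root_.pow_succ p e, pow_mul, hdL.map_pow_char p, mul_zero, zero_add]
        ring
      have hdz : dK (c' i₀) = 0 := by rw [hone, hdK.map_one]
      have hall : ∀ i ∈ s, dK (c' i) = 0 := by
        rw [← Finset.add_sum_erase s _ hi₀, hdz, _root_.map_zero, zero_mul, zero_add] at hd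
        have := ihs (s.erase i₀) (Finset.erase_ssubset hi₀)
          (hu.mono (by simp)) _ _ hd
        intro i hi
        by_cases h : i = i₀
        · rw [h, hdz]
        · exact this i (Finset.mem_erase.mpr ⟨h, hi⟩)
      choose! g hg using fun i hi ↦ (hstrict (c' i)).mp (hall i hi)
      have hpow : (∑ i ∈ s, algebraMap K L (g i) * u i ^ p ^ e) ^ p = 0 := by
        rw [sum_pow_char, ← hsum]
        refine Finset.sum_congr rfl fun i hi ↦ ?_
        rw [mul_pow, ← _root_.map_pow, hg i hi, ← pow_mul, ← _root_.pow_succ]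
      have hgz := ihe g (eq_zero_of_pow_eq_zero hpow) i₀ hi₀
      have := hg i₀ hi₀
      rw [hgz, hone, zero_pow (Fact.out : p.Prime).ne_zero] at this
      exact zero_ne_one this

theorem IsFrDeriv.linearIndepOn_pow [CharP L p]
    (hdK : IsFrDeriv (p ^ n) dK) (hdL : IsFrDeriv (p ^ n) dL)
    (hcompat : ∀ x : K, dL (algebraMap K L x) = algebraMap K L (dK x))
    (hstrict : ∀ x : K, dK x = 0 ↔ ∃ y : K, y ^ p = x) (s : Finset L)
    (hs : LinearIndepOn K _root_.id (s : Set L)) : LinearIndepOn K (· ^ p) (s : Set L) := by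
  refine linearIndepOn_finset_iff.mpr fun c hc ↦ ?_
  refine hdK.eq_zero_of_sum_mul_pow_eq_zero hdL hcompat hstrict _ s hs 1 c ?_
  simpa [Algebra.smul_def] using hc

theorem IsFrDeriv.exists_map_aeval [CharP K p] [CharP L p] (hdL : IsFrDeriv (p ^ n) dL)
    (hcompat : ∀ x : K, dL (algebraMap K L x) = algebraMap K L (dK x))
    (hn : 0 < n) {ι : Type*} [Fintype ι] (x : ι → L) (g : MvPolynomial ι K) :
    ∃ h : MvPolynomial ι K, (∀ i, pderiv i h = 0) ∧
      dL (aeval x g) = aeval x h + ∑ j, aeval x (pderiv j g) ^ p ^ n * dL (x j) := by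
  classical
  have hq : ((p ^ n : ℕ) : MvPolynomial ι K) = 0 := by
    rw [Nat.cast_pow, CharP.cast_eq_zero, zero_pow hn.ne']
  have hq' : p ^ n ≠ 0 := pow_ne_zero _ (Fact.out : p.Prime).ne_zero
  induction g using MvPolynomial.induction_on with
  | C c => exact ⟨C (dK c), by simp, by simp [hcompat, zero_pow hq']⟩
  | add g₁ g₂ ih₁ ih₂ =>
    obtain ⟨h₁, hz₁, he₁⟩ := ih₁
    obtain ⟨h₂, hz₂, he₂⟩ := ih₂
    refine ⟨h₁ + h₂, by simp [hz₁, hz₂], ?_⟩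
    simp only [_root_.map_add, hdL.1, he₁, he₂, add_pow_char_pow, add_mul, Finset.sum_add_distrib]
    ring
  | mul_X g i ih =>
    obtain ⟨h, hz, he⟩ := ih
    refine ⟨h * X i ^ p ^ n, fun j ↦ ?_, ?_⟩
    · rw [pderiv_mul, hz, pderiv_pow, hq]
      simp
    · have hterm (j : ι) : aeval x (pderiv j (g * X i)) ^ p ^ n * dL (x j) =
          x i ^ p ^ n * (aeval x (pderiv j g) ^ p ^ n * dL (x j)) +
            if i = j then aeval x g ^ p ^ n * dL (x j) else 0 := by
        rw [pderiv_mul, _root_.map_add, add_pow_char_pow, _root_.map_mul, mul_pow, pderiv_X,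
          Pi.single_apply, aeval_X]
        split_ifs <;> simp [zero_pow hq'] <;> ring
      simp only [hterm, Finset.sum_add_distrib, ← Finset.mul_sum, _root_.map_mul, aeval_X,
        hdL.2, he, _root_.map_pow, Finset.sum_ite_eq, Finset.mem_univ, if_true]
      ring

theorem MvPolynomial.exists_aeval_pderiv_ne_zero [CharP K p]
    (H : ∀ s : Finset L, LinearIndepOn K _root_.id (s : Set L) →
      LinearIndepOn K (· ^ p) (s : Set L))
    {ι : Type*} {x : ι → L} (hx : ¬ AlgebraicIndependent K x) :
    ∃ (f : MvPolynomial ι K) (i : ι), aeval x f = 0 ∧ aeval x (pderiv i f) ≠ 0 := by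
  obtain ⟨f₀, hf₀, hf₀'⟩ : ∃ f : MvPolynomial ι K, aeval x f = 0 ∧ f ≠ 0 := by
    simpa [algebraicIndependent_iff] using hx
  obtain ⟨f, ⟨hf0, hfx⟩, hmin⟩ := exists_minimalFor_of_wellFoundedLT
    (fun f : MvPolynomial ι K ↦ f ≠ 0 ∧ aeval x f = 0) totalDegree ⟨f₀, hf₀', hf₀⟩
  have HF (g : MvPolynomial ι K) (hg : g ≠ 0) (hgx : aeval x g = 0) :
      f.totalDegree ≤ g.totalDegree :=
    (le_total _ _).elim _root_.id (hmin ⟨hg, hgx⟩)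
  obtain ⟨i, σ, hσ, hσi⟩ := exists_mem_support_not_dvd_of_forall_totalDegree_le p Fact.out H
    HF hf0 hfx
  refine ⟨f, i, hfx, fun hz ↦ ?_⟩
  have hσ0 : σ i ≠ 0 := fun h ↦ hσi (h ▸ dvd_zero p)
  have hle : Finsupp.single i 1 ≤ σ := by
    rw [Finsupp.single_le_iff]; omega
  have hne : pderiv i f ≠ 0 := fun h ↦ by
    have h' := coeff_pderiv (i := i) f (σ - Finsupp.single i 1)
    rw [h, tsub_add_cancel_of_le hle, coeff_zero, eq_comm, mul_eq_zero] at h'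
    refine h'.elim (mem_support_iff.mp hσ) fun h' ↦ hσi ?_
    rw [← CharP.cast_eq_zero_iff K p, ← h', ← Nat.cast_succ]
    congr 1
    simp
    omega
  have hdeg := HF _ hne hz
  have hlt : (pderiv i f).totalDegree < f.totalDegree := by
    obtain ⟨τ, hτ, hτd⟩ := Finset.exists_mem_eq_sup _ (support_nonempty.mpr hne)
      fun s : ι →₀ ℕ ↦ s.sum fun _ e ↦ e
    have hτ' : τ + Finsupp.single i 1 ∈ f.support := by
      rw [mem_support_iff, coeff_pderiv] at hτ
      exact mem_support_iff.mpr (left_ne_zero_of_mul hτ)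
    have := le_totalDegree hτ'
    rw [Finsupp.sum_add_index' (by simp) (by simp), Finsupp.sum_single_index rfl] at this
    rw [totalDegree, hτd]
    omega
  omega

theorem isSeparable_of_aeval_pderiv_last_ne_zero {m : ℕ} {x : Fin (m + 1) → L}
    {g : MvPolynomial (Fin (m + 1)) K} (hg : aeval x g = 0)
    (hg' : aeval x (pderiv (Fin.last m) g) ≠ 0) (F : IntermediateField K L)
    (hF : ∀ j : Fin m, x j.castSucc ∈ F) : IsSeparable F (x (Fin.last m)) := by
  let y : Fin (m + 1) → Polynomial F :=
    Fin.lastCases Polynomial.X fun j ↦ Polynomial.C ⟨x j.castSucc, hF j⟩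
  have heval (f : MvPolynomial (Fin (m + 1)) K) :
      Polynomial.aeval (x (Fin.last m)) (aeval y f) = aeval x f := by
    have : ((Polynomial.aeval (x (Fin.last m)) : Polynomial F →ₐ[F] L).restrictScalars K).comp
        (aeval y) = aeval x := by
      ext j
      refine Fin.lastCases ?_ (fun j ↦ ?_) j <;> simp [y]
    exact DFunLike.congr_fun this f
  have hder (f : MvPolynomial (Fin (m + 1)) K) :
      Polynomial.derivative (aeval y f) = aeval y (pderiv (Fin.last m) f) := by
    induction f using MvPolynomial.induction_on with
    | C c => simp [IsScalarTower.algebraMap_apply K F (Polynomial F)]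
    | add f₁ f₂ h₁ h₂ => simp [h₁, h₂]
    | mul_X f j h =>
      rw [_root_.map_mul, Polynomial.derivative_mul, h, pderiv_mul, aeval_X, _root_.map_add,
        _root_.map_mul, _root_.map_mul, aeval_X]
      congr 2
      refine Fin.lastCases ?_ (fun j ↦ ?_) j
      · simp [y]
      · simp [y, pderiv_X_of_ne (Fin.castSucc_lt_last j).ne]
  have hP := (heval g).trans hg
  have hP' : Polynomial.aeval (x (Fin.last m)) (Polynomial.derivative (aeval y g)) ≠ 0 := by
    rwa [hder, heval]
  have hint : IsIntegral F (x (Fin.last m)) :=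
    isAlgebraic_iff_isIntegral.mp ⟨aeval y g, fun h ↦ hP' (by simp [h]), hP⟩
  refine (Polynomial.separable_iff_derivative_ne_zero (minpoly.irreducible hint)).mpr fun h ↦ hP' ?_
  obtain ⟨Q, hQ⟩ := minpoly.dvd F _ hP
  rw [hQ, Polynomial.derivative_mul, h]
  simp

end

theorem stmt13 (p n : ℕ) [Fact p.Prime] (hn : 0 < n)
    {K L : Type*} [Field K] [Field L] [Algebra K L] [CharP K p] [CharP L p]
    (dK : K → K) (dL : L → L)
    (hdK : IsFrDeriv (p ^ n) dK) (hdL : IsFrDeriv (p ^ n) dL)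
    (hcompat : ∀ x : K, dL (algebraMap K L x) = algebraMap K L (dK x))
    (hstrict : ∀ x : K, dK x = 0 ↔ ∃ y : K, y ^ p = x)
    (a : L) (m : ℕ) (hm : 0 < m)
    (halg : IsAlgebraic
      (IntermediateField.adjoin K (Set.range fun i : Fin m => dL^[(i : ℕ)] a))
      (dL^[m] a)) :
    IsSeparable
      (IntermediateField.adjoin K (Set.range fun i : Fin m => dL^[(i : ℕ)] a))
      (dL^[m] a) := by
  let x : Fin (m + 1) → L := fun i ↦ dL^[(i : ℕ)] a
  have hx : ¬ AlgebraicIndependent K x := fun h ↦ by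
    have := h.transcendental_adjoin (s := Set.range Fin.castSucc) (i := Fin.last m) (by simp)
    rw [← Set.range_comp] at this
    exact this (IntermediateField.isAlgebraic_adjoin_iff.mp halg)
  obtain ⟨f, i, hf, hfi⟩ := MvPolynomial.exists_aeval_pderiv_ne_zero
    (hdK.linearIndepOn_pow hdL hcompat hstrict) hx
  obtain ⟨g, hg, hg'⟩ : ∃ g : MvPolynomial (Fin (m + 1)) K, MvPolynomial.aeval x g = 0 ∧
      MvPolynomial.aeval x (MvPolynomial.pderiv (Fin.last m) g) ≠ 0 := by
    by_contra! hlast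
    refine hfi ?_
    clear hfi
    induction i using Fin.reverseInduction generalizing f with
    | last => exact hlast f hf
    | cast i ih =>
      obtain ⟨h, hz, he⟩ := hdL.exists_map_aeval hcompat hn x f
      have hsucc (j : Fin m) : dL (x j.castSucc) = x j.succ :=
        (Function.iterate_succ_apply' dL j a).symm
      have hq : p ^ n ≠ 0 := pow_ne_zero _ (Fact.out : p.Prime).ne_zero
      rw [hf, hdL.map_zero, Fin.sum_univ_castSucc, hlast f hf, zero_pow hq, zero_mul, add_zero]
        at he
      simp only [hsucc] at he
      have := ih (h + ∑ j : Fin m, MvPolynomial.pderiv j.castSucc f ^ p ^ n *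
        MvPolynomial.X j.succ) (by simp [he])
      have hq0 : ((p ^ n : ℕ) : MvPolynomial (Fin (m + 1)) K) = 0 := by
        rw [Nat.cast_pow, CharP.cast_eq_zero, zero_pow hn.ne']
      rw [map_add, hz, zero_add, map_sum, Finset.sum_eq_single i] at this
      · rw [MvPolynomial.pderiv_mul, MvPolynomial.pderiv_pow, hq0] at this
        exact pow_eq_zero_iff hq |>.mp (by simpa using this)
      · intro j _ hj
        rw [MvPolynomial.pderiv_mul, MvPolynomial.pderiv_pow, hq0,
          MvPolynomial.pderiv_X_of_ne (by simpa using hj)]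
        simp
      · simp
  exact isSeparable_of_aeval_pderiv_last_ne_zero hg hg' _ fun j ↦
    IntermediateField.subset_adjoin _ _ ⟨j, rfl⟩
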